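/- arXiv:1803.02203 — 2 statements merged into one kernel-verified Lean document; each statement's English description precedes it below -/
import Mathlib

section
/- Let U be a nonempty set, L ≥ 0, f̄ > 0, V* > 0, δ > 0, α > 0, ε > 0, ε₁ ≥ 0, η ≥ 0. Let f : ℝⁿ × U → ℝⁿ satisfy ‖f(a, u) − f(b, u)‖ ≤ L‖a − b‖ and ‖f(a, u)‖ ≤ f̄ for all a, b ∈ ℝⁿ, u ∈ U. Let V : ℝⁿ → ℝ be bounded below, x₀ ∈ ℝⁿ, let y be an ε²-minimizer of the inf-convolution of V at x₀ with ‖y − x₀‖ ≤ √(2V*)·α, set ζ := (x₀ − y)/α², assume V(x₀) − V(y) ≤ ε₁, assume inf_{u ∈ U} ⟨ζ, f(y, u)⟩ > −∞, and let κ ∈ U satisfy ⟨ζ, f(y, κ)⟩ ≤ inf_{u ∈ U} ⟨ζ, f(y, u)⟩ + η. Let x : [0, δ] → ℝⁿ satisfy x(0) = x₀ and x(t) = x₀ + ∫₀^t f(x(τ), κ) dτ for all t ∈ [0, δ]. Then the per-sample decay estimate holds: V_α(x(δ)) − V_α(x₀) ≤ δ·( inf_{u ∈ U} ⟨ζ,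 f(y, u)⟩ + 2L(ε₁ + ε²) + η + (√(2V*)/α)·δ·L·f̄ + δ·f̄²/(2α²) ) + ε². -/
open scoped RealInnerProductSpace

open MeasureTheory in
theorem traj_integrable {n : ℕ} (fbar δ L : ℝ) (hfb : 0 < fbar) (hδ : 0 < δ)
    (F : EuclideanSpace ℝ (Fin n) → EuclideanSpace ℝ (Fin n))
    (hF : Continuous F) (hb : ∀ a, ‖F a‖ ≤ fbar) (x₀ : EuclideanSpace ℝ (Fin n))
    (x : ℝ → EuclideanSpace ℝ (Fin n))
    (hx : ∀ t ∈ Set.Icc (0 : ℝ) δ, x t = x₀ + ∫ τ in (0 : ℝ)..t, F (x τ)) :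
    IntervalIntegrable (fun τ => F (x τ)) volume 0 δ := by
  set A : Set ℝ := {t | t ∈ Set.Icc 0 δ ∧ IntervalIntegrable (fun τ => F (x τ)) volume 0 t} with hA
  have hord : A.OrdConnected := by
    refine ⟨fun a ha b hb' c hc => ⟨⟨ha.1.1.trans hc.1, hc.2.trans hb'.1.2⟩, ?_⟩⟩
    refine hb'.2.mono_set ?_
    have h0 : 0 ≤ c := ha.1.1.trans hc.1
    rw [Set.uIcc_of_le h0, Set.uIcc_of_le (h0.trans hc.2)]
    exact Set.Icc_subset_Icc le_rfl hc.2
  have hAm : MeasurableSet A := hord.measurableSet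
  have hcont : ContinuousOn x A := by
    have : LipschitzOnWith (Real.toNNReal fbar) x A := by
      refine LipschitzOnWith.of_dist_le_mul fun s hs t ht => ?_
      rw [dist_eq_norm, hx s hs.1, hx t ht.1, add_sub_add_left_eq_sub,
        intervalIntegral.integral_interval_sub_left hs.2 ht.2, Real.coe_toNNReal _ hfb.le,
        Real.dist_eq]
      exact intervalIntegral.norm_integral_le_of_norm_le_const (fun τ _ => hb _)
    exact this.continuousOn
  have hx1 : AEStronglyMeasurable (fun τ => F (x τ)) (volume.restrict A) :=
    (hF.comp_continuousOn hcont).aestronglyMeasurable hAm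
  have hx2 : AEStronglyMeasurable (fun τ => F (x τ)) (volume.restrict (Set.Icc 0 δ \ A)) := by
    refine (aestronglyMeasurable_const (b := F x₀)).congr ?_
    filter_upwards [ae_restrict_mem (measurableSet_Icc.diff hAm)] with t ht
    have h2 : ¬ IntervalIntegrable (fun τ => F (x τ)) volume 0 t := fun h => ht.2 ⟨ht.1, h⟩
    rw [hx t ht.1, intervalIntegral.integral_undef h2, add_zero]
  have hx3 : AEStronglyMeasurable (fun τ => F (x τ)) (volume.restrict (A ∪ Set.Icc 0 δ \ A)) :=
    aestronglyMeasurable_union_iff.2 ⟨hx1, hx2⟩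
  rw [intervalIntegrable_iff_integrableOn_Ioc_of_le hδ.le]
  have h4 : Set.Ioc 0 δ ⊆ A ∪ Set.Icc 0 δ \ A := by
    rw [Set.union_sdiff_self]
    exact fun t ht => Or.inr ⟨ht.1.le, ht.2⟩
  exact Integrable.of_bound (hx3.mono_set h4) fbar
    (Filter.Eventually.of_forall fun t => hb _)

/-- per-sample decay estimate for the inf-convolution of the CLF along the
sample-and-hold trajectory under approximate optimizers. -/
theorem stmt_12 (n : ℕ) (U : Type*) [Nonempty U]
    (L fbar Vstar δ α ε ε₁ η : ℝ)
    (hL : 0 ≤ L) (hfbar : 0 < fbar) (hVstar : 0 < Vstar) (hδ : 0 < δ)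
    (hα : 0 < α) (hε : 0 < ε) (hε₁ : 0 ≤ ε₁) (hη : 0 ≤ η)
    (f : EuclideanSpace ℝ (Fin n) → U → EuclideanSpace ℝ (Fin n))
    (hfLip : ∀ (a b : EuclideanSpace ℝ (Fin n)) (u : U), ‖f a u - f b u‖ ≤ L * ‖a - b‖)
    (hfbdd : ∀ (a : EuclideanSpace ℝ (Fin n)) (u : U), ‖f a u‖ ≤ fbar)
    (V : EuclideanSpace ℝ (Fin n) → ℝ) (hVbdd : BddBelow (Set.range V))
    (x₀ y : EuclideanSpace ℝ (Fin n))
    (hy : V y + ‖y - x₀‖ ^ 2 / (2 * α ^ 2) ≤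
      (⨅ z : EuclideanSpace ℝ (Fin n), (V z + ‖z - x₀‖ ^ 2 / (2 * α ^ 2))) + ε ^ 2)
    (hynear : ‖y - x₀‖ ≤ Real.sqrt (2 * Vstar) * α)
    (ζ : EuclideanSpace ℝ (Fin n)) (hζ : ζ = (α ^ 2)⁻¹ • (x₀ - y))
    (hVdiff : V x₀ - V y ≤ ε₁)
    (hinfbdd : BddBelow (Set.range fun u : U => ⟪ζ, f y u⟫))
    (κ : U) (hκ : ⟪ζ, f y κ⟫ ≤ (⨅ u : U, ⟪ζ, f y u⟫) + η)
    (x : ℝ → EuclideanSpace ℝ (Fin n)) (hx0 : x 0 = x₀)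
    (hx : ∀ t ∈ Set.Icc (0 : ℝ) δ, x t = x₀ + ∫ τ in (0 : ℝ)..t, f (x τ) κ) :
    (⨅ z : EuclideanSpace ℝ (Fin n), (V z + ‖z - x δ‖ ^ 2 / (2 * α ^ 2))) -
      (⨅ z : EuclideanSpace ℝ (Fin n), (V z + ‖z - x₀‖ ^ 2 / (2 * α ^ 2))) ≤
    δ * ((⨅ u : U, ⟪ζ, f y u⟫) + 2 * L * (ε₁ + ε ^ 2) + η +
      (Real.sqrt (2 * Vstar) / α) * δ * L * fbar + δ * fbar ^ 2 / (2 * α ^ 2)) + ε ^ 2 := by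
  have hF : Continuous fun a => f a κ :=
    (LipschitzWith.of_dist_le_mul (K := Real.toNNReal L) fun a b => by
      rw [dist_eq_norm, dist_eq_norm, Real.coe_toNNReal _ hL]; exact hfLip a b κ).continuous
  have hint := traj_integrable fbar δ L hfbar hδ (fun a => f a κ) hF (fun a => hfbdd a κ) x₀ x hx
  have hdev : ∀ t ∈ Set.Icc 0 δ, ‖x t - x₀‖ ≤ fbar * δ := by
    intro t ht
    rw [hx t ht, add_sub_cancel_left]
    refine (intervalIntegral.norm_integral_le_of_norm_le_const (fun τ _ => hfbdd _ κ)).trans ?_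
    rw [sub_zero, abs_of_nonneg ht.1]
    exact mul_le_mul_of_nonneg_left ht.2 hfbar.le
  have hbd : ∀ r : EuclideanSpace ℝ (Fin n), BddBelow
      (Set.range fun z : EuclideanSpace ℝ (Fin n) => V z + ‖z - r‖ ^ 2 / (2 * α ^ 2)) := by
    intro r
    obtain ⟨m, hm⟩ := hVbdd
    refine ⟨m, ?_⟩
    rintro _ ⟨z, rfl⟩
    have h1 : m ≤ V z := hm ⟨z, rfl⟩
    have h2 : 0 ≤ ‖z - r‖ ^ 2 / (2 * α ^ 2) := by positivity
    show m ≤ V z + ‖z - r‖ ^ 2 / (2 * α ^ 2)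
    linarith
  have h1 := ciInf_le (hbd (x δ)) y
  have h0 := ciInf_le (hbd x₀) x₀
  simp only [sub_self, norm_zero, ne_eq, OfNat.ofNat_ne_zero, not_false_eq_true, zero_pow,
    zero_div, add_zero] at h0
  set D := x δ - x₀ with hD
  set d := ‖y - x₀‖ with hd
  have hd0 : 0 ≤ d := norm_nonneg _
  have hDn : ‖D‖ ≤ fbar * δ := hdev δ ⟨hδ.le, le_rfl⟩
  have hE : ‖D - δ • f y κ‖ ≤ L * (fbar * δ + d) * δ := by
    have : D - δ • f y κ = ∫ τ in (0:ℝ)..δ, (f (x τ) κ - f y κ) := by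
      rw [intervalIntegral.integral_sub hint intervalIntegrable_const, hD,
        hx δ ⟨hδ.le, le_rfl⟩, add_sub_cancel_left, intervalIntegral.integral_const, sub_zero]
    rw [this]
    refine (intervalIntegral.norm_integral_le_of_norm_le_const
      (C := L * (fbar * δ + d)) (fun τ hτ => ?_)).trans ?_
    · rw [Set.uIoc_of_le hδ.le] at hτ
      refine (hfLip _ _ _).trans (mul_le_mul_of_nonneg_left ?_ hL)
      have e : x τ - y = (x τ - x₀) - (y - x₀) := by abel
      rw [e]
      exact (norm_sub_le _ _).trans (by linarith [hdev τ ⟨hτ.1.le, hτ.2⟩])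
    · rw [sub_zero, abs_of_pos hδ]
  have hζn : ‖ζ‖ = d / α ^ 2 := by
    rw [hζ, norm_smul, norm_sub_rev, Real.norm_of_nonneg (by positivity), ← hd]
    field_simp
  have hin : ⟪ζ, D⟫ ≤ δ * ⟪ζ, f y κ⟫ + d / α ^ 2 * (L * (fbar * δ + d) * δ) := by
    have e : D = δ • f y κ + (D - δ • f y κ) := by abel
    have e2 : ⟪ζ, D⟫ = δ * ⟪ζ, f y κ⟫ + ⟪ζ, D - δ • f y κ⟫ := by
      conv_lhs => rw [e, inner_add_right, inner_smul_right]
    rw [e2]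
    have := (real_inner_le_norm ζ (D - δ • f y κ)).trans
      (mul_le_mul_of_nonneg_left hE (norm_nonneg _))
    rw [hζn] at this
    linarith
  have hexp : ‖y - x δ‖ ^ 2 / (2 * α ^ 2) = d ^ 2 / (2 * α ^ 2) + ⟪ζ, D⟫ + ‖D‖ ^ 2 / (2 * α ^ 2) := by
    have e : y - x δ = (y - x₀) - D := by rw [hD]; abel
    have e3 : x₀ - y = -(y - x₀) := by abel
    rw [e, norm_sub_sq_real, hζ, inner_smul_left, e3, inner_neg_left]
    simp only [conj_trivial]
    field_simp
    ring
  have hDD : ‖D‖ ^ 2 / (2 * α ^ 2) ≤ δ * (δ * fbar ^ 2 / (2 * α ^ 2)) := by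
    have : ‖D‖ ^ 2 ≤ (fbar * δ) ^ 2 := by gcongr
    calc _ ≤ (fbar * δ) ^ 2 / (2 * α ^ 2) := by gcongr
      _ = _ := by ring
  have hdd : d * d / α ^ 2 ≤ 2 * (ε₁ + ε ^ 2) := by
    have e : d * d / α ^ 2 = 2 * (d ^ 2 / (2 * α ^ 2)) := by field_simp
    rw [e]; linarith
  have hda : d / α ^ 2 ≤ Real.sqrt (2 * Vstar) / α := by
    rw [div_le_div_iff₀ (by positivity) hα]
    nlinarith
  have k1 : d * d / α ^ 2 * (L * δ) ≤ 2 * (ε₁ + ε ^ 2) * (L * δ) := by gcongr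
  have k2 : d / α ^ 2 * (L * (fbar * δ) * δ) ≤ Real.sqrt (2 * Vstar) / α * (L * (fbar * δ) * δ) := by
    gcongr
  have k3 : δ * ⟪ζ, f y κ⟫ ≤ δ * ((⨅ u : U, ⟪ζ, f y u⟫) + η) := by gcongr
  have k4 : d / α ^ 2 * (L * (fbar * δ + d) * δ) =
      d * d / α ^ 2 * (L * δ) + d / α ^ 2 * (L * (fbar * δ) * δ) := by ring
  rw [hexp] at h1
  generalize (⨅ u : U, ⟪ζ, f y u⟫) = I at *
  linarith
end

section
/- Let U ⊆ ℝᵐ and let f : ℝⁿ × U → ℝⁿ satisfy the local Lipschitz condition: for every c ∈ ℝⁿ and r > 0 there is L(c, r) ≥ 0 such that ‖f(a, u) − f(b, u)‖ ≤ L(c, r)·‖a − b‖ for all a, b with ‖a − c‖ ≤ r, ‖b − c‖ ≤ r and all u ∈ U. Let V : ℝⁿ → ℝ be locally Lipschitz, positive definite (V(0) = 0, V(x) > 0 for x ≠ 0) and radially unbounded, and let w : ℝⁿ → ℝ be continuous with w(x) > 0 for x ≠ 0, such that the decay condition holds: for every compact set X ⊆ ℝⁿ there is a compact set U_X ⊆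 U with inf_{ϑ ∈ co(f(x, U_X))} D_ϑV(x) ≤ −w(x) for all x ∈ X, where co denotes the closed convex hull and D_ϑV the lower directional Dini derivative. Assume further the uniform Dini assumption: V is everywhere lower Dini-differentiable in every direction (the liminf defining D_ϑV(x) is a limit-type locally uniform infimum), i.e. for all compact sets Y, F ⊆ ℝⁿ and every ν > 0 there exists μ > 0 such that |(V(y + μ'ϑ) − V(y))/μ' − D_ϑV(y)| ≤ ν for all y ∈ Y, ϑ ∈ F and 0 < μ' ≤ μ. Then for all R > r > 0 there exist a sampling period δ > 0, a parameter α ∈ (0,1), a compact set U* ⊆ U, a reaching time T > 0, a bound Θ > 0, and accuracy thresholds ε̄ : ℝⁿ → (0,∞) and η̄ > 0 with the following property. Consider any sequence of control actions produced by the approximate inf-convolution feedback: given x_k ∈ ℝⁿ, choose y_k with V(y_k) + ‖y_k − x_k‖²/(2α²) ≤ inf_{y}( V(y) + ‖y − x_k‖²/(2α²) ) + ε̄(x_k)², set ζ_k := (x_k − y_k)/α², and choose u_k ∈ U* with ⟨ζ_k, f(y_k, u_k)⟩ ≤ inf_{u ∈ U*} ⟨ζ_k, f(y_k, u)⟩ +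 η̄. Then every sample-and-hold trajectory x : [0, ∞) → ℝⁿ with ‖x(0)‖ ≤ R, x_k := x(kδ), which on each interval [kδ, (k+1)δ] satisfies x(t) = x_k + ∫_{kδ}^t f(x(τ), u_k) dτ, remains bounded (V(x(t)) ≤ Θ for all t ≥ 0) and satisfies ‖x(t)‖ ≤ r for all t ≥ T. -/
open scoped RealInnerProductSpace
open Filter

lemma traj_aux {E : Type*} [NormedAddCommGroup E] [NormedSpace ℝ E] [CompleteSpace E]
    (g : E → E) (hg : Continuous g) (x : ℝ → E) (a b : ℝ) (hab : a < b) (M : ℝ)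
    (hx : ∀ t ∈ Set.Icc a b, x t = x a + ∫ τ in a..t, g (x τ))
    (hb : ∀ z, ‖z - x a‖ ≤ 1 → ‖g z‖ ≤ M) (hMb : M * (b - a) < 1) :
    IntervalIntegrable (fun τ => g (x τ)) MeasureTheory.volume a b ∧
      ∀ t ∈ Set.Icc a b, ‖x t - x a‖ ≤ M * (b - a) := by
  have hM : 0 ≤ M := (norm_nonneg _).trans (hb (x a) (by simp))
  have hcont : ∀ t ∈ Set.Icc a b, IntervalIntegrable (fun τ => g (x τ)) MeasureTheory.volume a t →
      ContinuousOn x (Set.Icc a t) := by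
    intro t ht hi
    have h1 := intervalIntegral.continuousOn_primitive_interval' hi Set.left_mem_uIcc
    rw [Set.uIcc_of_le ht.1] at h1
    have h2 : ContinuousOn (fun s => x a + ∫ τ in a..s, g (x τ)) (Set.Icc a t) :=
      continuousOn_const.add h1
    exact h2.congr (fun s hs => hx s ⟨hs.1, hs.2.trans ht.2⟩)
  have hest : ∀ t ∈ Set.Icc a b, (∀ τ ∈ Set.Ioc a t, ‖x τ - x a‖ ≤ 1) →
      ‖x t - x a‖ ≤ M * (b - a) := by
    intro t ht h
    rw [hx t ht, add_sub_cancel_left]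
    have h1 : ‖∫ τ in a..t, g (x τ)‖ ≤ M * |t - a| := by
      apply intervalIntegral.norm_integral_le_of_norm_le_const
      intro τ hτ
      rw [Set.uIoc_of_le ht.1] at hτ
      exact hb _ (h τ hτ)
    rw [abs_of_nonneg (by linarith [ht.1])] at h1
    exact h1.trans (mul_le_mul_of_nonneg_left (by linarith [ht.2]) hM)
  have hin : ∀ t ∈ Set.Icc a b, ‖x t - x a‖ ≤ 1 := by
    intro t ht
    by_cases hi : IntervalIntegrable (fun τ => g (x τ)) MeasureTheory.volume a t
    · by_contra hcon
      push Not at hcon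
      have hc := hcont t ht hi
      have hN : ContinuousOn (fun τ => ‖x τ - x a‖) (Set.Icc a t) :=
        (hc.sub continuousOn_const).norm
      have hne : ((Set.Icc a t) ∩ (fun τ => ‖x τ - x a‖) ⁻¹' {1}).Nonempty := by
        obtain ⟨s, hs, hs1⟩ := intermediate_value_Icc ht.1 hN
          (show (1:ℝ) ∈ Set.Icc _ _ from ⟨by simp, hcon.le⟩)
        exact ⟨s, hs, hs1⟩
      have hcomp : IsCompact ((Set.Icc a t) ∩ (fun τ => ‖x τ - x a‖) ⁻¹' {1}) :=
        isCompact_Icc.of_isClosed_subset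
          (hN.preimage_isClosed_of_isClosed isClosed_Icc isClosed_singleton) Set.inter_subset_left
      obtain ⟨s, ⟨hs, hs1⟩, hsl⟩ := hcomp.exists_isLeast hne
      have hs1' : ‖x s - x a‖ = 1 := hs1
      have := hest s ⟨hs.1, hs.2.trans ht.2⟩ (by
        intro τ hτ
        by_contra hc2
        push Not at hc2
        obtain ⟨s', hs', hs1''⟩ := intermediate_value_Icc hτ.1.le
          (hN.mono (Set.Icc_subset_Icc_right (hτ.2.trans hs.2)))
          (show (1:ℝ) ∈ Set.Icc _ _ from ⟨by simp, hc2.le⟩)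
        have h5 : s ≤ s' := hsl ⟨⟨hs'.1, hs'.2.trans (hτ.2.trans hs.2)⟩, hs1''⟩
        have h6 : τ = s := le_antisymm hτ.2 (h5.trans hs'.2)
        rw [h6, hs1'] at hc2
        exact lt_irrefl _ hc2)
      linarith
    · rw [hx t ht, intervalIntegral.integral_undef hi]; simp
  refine ⟨?_, fun t ht => hest t ht (fun τ hτ => hin τ ⟨hτ.1.le, hτ.2.trans ht.2⟩)⟩
  set J : Set ℝ := {t | t ∈ Set.Icc a b ∧
    IntervalIntegrable (fun τ => g (x τ)) MeasureTheory.volume a t} with hJ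
  have haJ : a ∈ J := ⟨⟨le_rfl, hab.le⟩, by simp⟩
  have hbd : BddAbove J := ⟨b, fun t ht => ht.1.2⟩
  have hc1 : ContinuousOn x (Set.Ico a (sSup J)) := by
    intro τ hτ
    obtain ⟨t, htJ, hlt⟩ := exists_lt_of_lt_csSup ⟨a, haJ⟩ hτ.2
    have h1 := hcont t htJ.1 htJ.2 τ ⟨hτ.1, hlt.le⟩
    refine h1.mono_of_mem_nhdsWithin ?_
    have : Set.Iio t ∈ nhdsWithin τ (Set.Ico a (sSup J)) :=
      mem_nhdsWithin_of_mem_nhds (Iio_mem_nhds hlt)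
    filter_upwards [this, self_mem_nhdsWithin] with s hs1 hs2
    exact ⟨hs2.1, le_of_lt hs1⟩
  have hc2 : ContinuousOn x (Set.Ioc (sSup J) b) := by
    have : ContinuousOn (fun _ : ℝ => x a) (Set.Ioc (sSup J) b) := continuousOn_const
    refine this.congr ?_
    intro τ hτ
    have hτ' : τ ∈ Set.Icc a b := ⟨(le_csSup hbd haJ).trans hτ.1.le, hτ.2⟩
    have hni : ¬ IntervalIntegrable (fun τ => g (x τ)) MeasureTheory.volume a τ := by
      intro hi
      exact absurd (le_csSup hbd (show τ ∈ J from ⟨hτ', hi⟩)) (not_le.mpr hτ.1)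
    rw [hx τ hτ', intervalIntegral.integral_undef hni]; simp
  have hm1 := (hg.comp_continuousOn hc1).aestronglyMeasurable (μ := MeasureTheory.volume)
    measurableSet_Ico
  have hm2 := (hg.comp_continuousOn hc2).aestronglyMeasurable (μ := MeasureTheory.volume)
    measurableSet_Ioc
  have hm3 : MeasureTheory.AEStronglyMeasurable (fun τ => g (x τ))
      (MeasureTheory.volume.restrict {sSup J}) := by
    rw [MeasureTheory.Measure.restrict_singleton]; simp
  have hm : MeasureTheory.AEStronglyMeasurable (fun τ => g (x τ))
      (MeasureTheory.volume.restrict (Set.Ioc a b)) := by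
    refine (aestronglyMeasurable_union_iff.mpr
      ⟨aestronglyMeasurable_union_iff.mpr ⟨hm1, hm3⟩, hm2⟩).mono_set ?_
    intro τ hτ
    rcases lt_trichotomy τ (sSup J) with h | h | h
    · exact Or.inl (Or.inl ⟨hτ.1.le, h⟩)
    · exact Or.inl (Or.inr h)
    · exact Or.inr ⟨h, hτ.2⟩
  rw [intervalIntegrable_iff_integrableOn_Ioc_of_le hab.le]
  refine ⟨hm, .restrict_of_bounded (C := M) (by simp) ?_⟩
  filter_upwards [MeasureTheory.ae_restrict_mem measurableSet_Ioc] with τ hτ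
  exact hb _ (hin τ ⟨hτ.1.le, hτ.2⟩)

lemma traj_aux2 {E : Type*} [NormedAddCommGroup E] [NormedSpace ℝ E] [CompleteSpace E]
    (g : E → E) (x : ℝ → E) (a b : ℝ) (hab : a < b)
    (hx : x b = x a + ∫ τ in a..b, g (x τ))
    (hi : IntervalIntegrable (fun τ => g (x τ)) MeasureTheory.volume a b) (c : E) (C : ℝ)
    (hC : ∀ t ∈ Set.Icc a b, ‖g (x t) - c‖ ≤ C) :
    ‖x b - x a - (b - a) • c‖ ≤ C * (b - a) := by
  have h1 : x b - x a - (b - a) • c = ∫ τ in a..b, (g (x τ) - c) := by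
    rw [intervalIntegral.integral_sub hi (by simp), hx]
    simp
  rw [h1]
  have := intervalIntegral.norm_integral_le_of_norm_le_const (a := a) (b := b) (C := C)
    (f := fun τ => g (x τ) - c) (by
      intro τ hτ
      rw [Set.uIoc_of_le hab.le] at hτ
      exact hC τ ⟨hτ.1.le, hτ.2⟩)
  rwa [abs_of_pos (by linarith)] at this

lemma dini_cont {E : Type*} [NormedAddCommGroup E] [NormedSpace ℝ E] [ProperSpace E]
    (V : E → ℝ) (hV : Continuous V) (D : E → E → ℝ)
    (hDini : ∀ Y F : Set E, IsCompact Y → IsCompact F →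
      ∀ ν : ℝ, 0 < ν → ∃ μ : ℝ, 0 < μ ∧ ∀ y ∈ Y, ∀ ϑ ∈ F, ∀ μ' : ℝ, 0 < μ' → μ' ≤ μ →
        |(V (y + μ' • ϑ) - V y) / μ' - D y ϑ| ≤ ν) :
    Continuous (fun p : E × E => D p.1 p.2) := by
  apply continuous_of_locally_uniform_approx_of_continuousAt
  intro p u hu
  obtain ⟨ε, hε, hεu⟩ := Metric.mem_uniformity_dist.mp hu
  obtain ⟨μ, hμ, h⟩ := hDini (Metric.closedBall p.1 1) (Metric.closedBall p.2 1)
    (isCompact_closedBall _ _) (isCompact_closedBall _ _) (ε / 2) (by linarith)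
  refine ⟨Metric.closedBall p 1, Metric.closedBall_mem_nhds _ one_pos,
    fun q => (V (q.1 + μ • q.2) - V q.1) / μ, ?_, ?_⟩
  · apply Continuous.continuousAt
    fun_prop
  · intro q hq
    have hq' : dist q p ≤ 1 := hq
    rw [Prod.dist_eq] at hq'
    apply hεu
    rw [Real.dist_eq, abs_sub_comm]
    have := h q.1 ((le_max_left _ _).trans hq') q.2 ((le_max_right _ _).trans hq') μ hμ le_rfl
    linarith

lemma finite_controls {E G : Type*} [NormedAddCommGroup E] [NormedSpace ℝ E]
    (f : E → G → E) (D : E → E → ℝ) (U UX : Set G) (hUX : UX ⊆ U) (hne : UX.Nonempty)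
    (hf : ∀ u ∈ U, Continuous (fun z => f z u))
    (hD : Continuous (fun p : E × E => D p.1 p.2)) (K : Set E) (hK : IsCompact K) (ω : ℝ)
    (hdec : ∀ x ∈ K, ∃ ϑ ∈ closure (convexHull ℝ ((fun u => f x u) '' UX)), D x ϑ < -ω) :
    ∃ S : Set G, S ⊆ U ∧ S.Finite ∧ S.Nonempty ∧
      ∀ x ∈ K, ∃ ϑ ∈ convexHull ℝ ((fun u => f x u) '' S), D x ϑ < -ω := by
  have key : ∃ S : Set G, S ⊆ U ∧ S.Finite ∧
      ∀ x ∈ K, ∃ ϑ ∈ convexHull ℝ ((fun u => f x u) '' S), D x ϑ < -ω := by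
    refine hK.induction_on (p := fun A => ∃ S : Set G, S ⊆ U ∧ S.Finite ∧
      ∀ x ∈ A, ∃ ϑ ∈ convexHull ℝ ((fun u => f x u) '' S), D x ϑ < -ω) ?_ ?_ ?_ ?_
    · exact ⟨∅, by simp, Set.finite_empty, by simp⟩
    · rintro s t hst ⟨S, h1, h2, h3⟩
      exact ⟨S, h1, h2, fun x hx => h3 x (hst hx)⟩
    · rintro s t ⟨S, h1, h2, h3⟩ ⟨S', h1', h2', h3'⟩
      refine ⟨S ∪ S', Set.union_subset h1 h1', h2.union h2', ?_⟩
      rintro x (hx | hx)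
      · obtain ⟨ϑ, h, h'⟩ := h3 x hx
        exact ⟨ϑ, convexHull_mono (Set.image_mono Set.subset_union_left) h, h'⟩
      · obtain ⟨ϑ, h, h'⟩ := h3' x hx
        exact ⟨ϑ, convexHull_mono (Set.image_mono Set.subset_union_right) h, h'⟩
    · intro x hx
      obtain ⟨ϑ, hϑ, hlt⟩ := hdec x hx
      have hDx : Continuous (fun v => D x v) := hD.comp (by fun_prop : Continuous fun v => (x, v))
      obtain ⟨ϑ1, h1, h2⟩ := mem_closure_iff.mp hϑ {v | D x v < -ω}
        (isOpen_lt hDx continuous_const) hlt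
      obtain ⟨ι, _, c, z, hc0, hc1, hz, hsum⟩ := mem_convexHull_iff_exists_fintype.mp h2
      choose v hv hvz using hz
      have hg : Continuous (fun y => ∑ i, c i • f y (v i)) := by
        refine continuous_finsetSum _ (fun i _ => ?_)
        exact (hf _ (hUX (hv i))).const_smul _
      have hDg : Continuous (fun y => D y (∑ i, c i • f y (v i))) :=
        hD.comp (continuous_id.prodMk hg)
      have hop : IsOpen {y | D y (∑ i, c i • f y (v i)) < -ω} := isOpen_lt hDg continuous_const
      have hxm : x ∈ {y | D y (∑ i, c i • f y (v i)) < -ω} := by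
        have : ∑ i, c i • f x (v i) = ϑ1 := by
          rw [← hsum]; exact Finset.sum_congr rfl (fun i _ => by rw [← hvz i])
        show D x _ < -ω
        rw [this]; exact h1
      refine ⟨_, mem_nhdsWithin_of_mem_nhds (hop.mem_nhds hxm), Set.range v, ?_,
        Set.finite_range v, ?_⟩
      · rintro _ ⟨i, rfl⟩; exact hUX (hv i)
      · intro y hy
        exact ⟨_, mem_convexHull_of_exists_fintype c (fun i => f y (v i)) hc0 hc1
          (fun i => ⟨v i, ⟨i, rfl⟩, rfl⟩) rfl, hy⟩
  obtain ⟨S, h1, h2, h3⟩ := key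
  obtain ⟨u0, hu0⟩ := hne
  refine ⟨insert u0 S, Set.insert_subset (hUX hu0) h1, h2.insert _, ⟨u0, by simp⟩, ?_⟩
  intro x hx
  obtain ⟨ϑ, h, h'⟩ := h3 x hx
  exact ⟨ϑ, convexHull_mono (Set.image_mono (Set.subset_insert _ _)) h, h'⟩

lemma small_aux (C e : ℝ) (hC : 0 ≤ C) (he : 0 < e) :
    ∃ a : ℝ, 0 < a ∧ ∀ s, 0 < s → s ≤ a → C * s ≤ e := by
  refine ⟨e / (C + 1), by positivity, fun s hs hsa => ?_⟩
  rw [le_div_iff₀ (by linarith)] at hsa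
  nlinarith

lemma prox_id {E : Type*} [NormedAddCommGroup E] [InnerProductSpace ℝ E]
    (α : ℝ) (x y x' : E) :
    ‖y - x'‖ ^ 2 / (2 * α ^ 2) = ‖y - x‖ ^ 2 / (2 * α ^ 2) + ⟪(α ^ 2)⁻¹ • (x - y), x' - x⟫
      + ‖x' - x‖ ^ 2 / (2 * α ^ 2) := by
  have h : y - x' = (y - x) - (x' - x) := by abel
  have h2 : x - y = -(y - x) := by abel
  rw [h, norm_sub_sq_real, h2, real_inner_smul_left, inner_neg_left]
  ring

lemma prox_grad {E : Type*} [NormedAddCommGroup E] [InnerProductSpace ℝ E]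
    (V : E → ℝ) (α ε μ : ℝ) (hμ : 0 < μ) (x y ϑ : E)
    (h : V y + ‖y - x‖ ^ 2 / (2 * α ^ 2) ≤
      V (y + μ • ϑ) + ‖(y + μ • ϑ) - x‖ ^ 2 / (2 * α ^ 2) + ε ^ 2) :
    ⟪(α ^ 2)⁻¹ • (x - y), ϑ⟫ ≤
      (V (y + μ • ϑ) - V y) / μ + μ * (‖ϑ‖ ^ 2 / (2 * α ^ 2)) + ε ^ 2 / μ := by
  have h1 := prox_id α y x (y + μ • ϑ)
  rw [add_sub_cancel_left, norm_smul, real_inner_smul_right, Real.norm_of_nonneg hμ.le,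
    norm_sub_rev x (y + μ • ϑ), norm_sub_rev x y] at h1
  have h2 : ⟪(α ^ 2)⁻¹ • (y - x), ϑ⟫ = - ⟪(α ^ 2)⁻¹ • (x - y), ϑ⟫ := by
    rw [← neg_sub x y, smul_neg, inner_neg_left]
  rw [h2] at h1
  rw [h1] at h
  set I := ⟪(α ^ 2)⁻¹ • (x - y), ϑ⟫
  have h3 : μ * I ≤ (V (y + μ • ϑ) - V y) + μ ^ 2 * (‖ϑ‖ ^ 2 / (2 * α ^ 2)) + ε ^ 2 := by
    have : (μ * ‖ϑ‖) ^ 2 / (2 * α ^ 2) = μ ^ 2 * (‖ϑ‖ ^ 2 / (2 * α ^ 2)) := by ring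
    linarith
  have h4 : (V (y + μ • ϑ) - V y) / μ + μ * (‖ϑ‖ ^ 2 / (2 * α ^ 2)) + ε ^ 2 / μ
    = ((V (y + μ • ϑ) - V y) + μ ^ 2 * (‖ϑ‖ ^ 2 / (2 * α ^ 2)) + ε ^ 2) / μ := by
    field_simp
  rw [h4, le_div_iff₀ hμ]
  linarith

lemma prox_bounds {E : Type*} [NormedAddCommGroup E]
    (V : E → ℝ) (hV0 : ∀ z, 0 ≤ V z) (c ρ₀ ρ LV α ε : ℝ) (hc : 1 ≤ c)
    (hρ₀ : ∀ z, V z ≤ c → ‖z‖ ≤ ρ₀) (hρ : ρ₀ + 2 * c ≤ ρ) (hLV : 0 ≤ LV)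
    (hL : ∀ a b, ‖a‖ ≤ ρ → ‖b‖ ≤ ρ → |V a - V b| ≤ LV * ‖a - b‖)
    (hα : 0 < α) (hα1 : α < 1) (hε : 0 < ε) (hεα : ε ≤ α) (x y : E)
    (h1 : V y + ‖y - x‖ ^ 2 / (2 * α ^ 2) ≤ c)
    (h2 : V y + ‖y - x‖ ^ 2 / (2 * α ^ 2) ≤ V x + ε ^ 2) :
    ‖y‖ ≤ ρ₀ ∧ ‖x‖ ≤ ρ₀ + 2 * c ∧ ‖y - x‖ ≤ (2 * LV + 2) * α ^ 2 := by
  have hq : 0 ≤ ‖y - x‖ ^ 2 / (2 * α ^ 2) := by positivity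
  have hy : ‖y‖ ≤ ρ₀ := hρ₀ y (by linarith)
  have hα2 : α ^ 2 ≤ 1 := by nlinarith
  have hα2p : 0 < α ^ 2 := by positivity
  have hd : ‖y - x‖ ≤ 2 * c := by
    have h3 : ‖y - x‖ ^ 2 / (2 * α ^ 2) ≤ c := by linarith [hV0 y]
    rw [div_le_iff₀ (by positivity)] at h3
    have h4 : ‖y - x‖ ^ 2 ≤ 2 * c := by nlinarith
    by_contra hcon
    push Not at hcon
    nlinarith
  have hx : ‖x‖ ≤ ρ₀ + 2 * c := by
    have : x = y - (y - x) := by abel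
    calc ‖x‖ = ‖y - (y - x)‖ := by rw [← this]
      _ ≤ ‖y‖ + ‖y - x‖ := norm_sub_le _ _
      _ ≤ _ := by linarith
  refine ⟨hy, hx, ?_⟩
  have h5 := (abs_le.mp (hL y x (by linarith) (by linarith))).1
  have h6 : ‖y - x‖ ^ 2 / (2 * α ^ 2) ≤ LV * ‖y - x‖ + α ^ 2 := by nlinarith
  rw [div_le_iff₀ (by positivity)] at h6
  by_contra hcon
  push Not at hcon
  set d := ‖y - x‖
  set A := α ^ 2
  have hd0 : 0 < d := lt_of_le_of_lt (by positivity) hcon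
  have hAd : 2 * A * d < d * d - 2 * LV * A * d := by nlinarith
  have : A < d := by nlinarith [mul_nonneg hLV hα2p.le]
  nlinarith

lemma one_step {E : Type*} [NormedAddCommGroup E] [InnerProductSpace ℝ E] [CompleteSpace E]
    (g : E → E) (hg : Continuous g) (x : ℝ → E) (y : E) (a b δ M ρ Lf Z α : ℝ)
    (hδ : 0 < δ) (hbδ : b = a + δ) (hZ : 0 ≤ Z) (hLf : 0 ≤ Lf) (hα : 0 < α)
    (hx : ∀ t ∈ Set.Icc a b, x t = x a + ∫ τ in a..t, g (x τ))
    (hM : ∀ z, ‖z‖ ≤ ρ → ‖g z‖ ≤ M)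
    (hgL : ∀ z z', ‖z‖ ≤ ρ → ‖z'‖ ≤ ρ → ‖g z - g z'‖ ≤ Lf * ‖z - z'‖)
    (hxa : ‖x a‖ + 1 ≤ ρ) (hy : ‖y‖ ≤ ρ) (hMδ : M * δ < 1)
    (hyx : ‖y - x a‖ ≤ Z * α ^ 2) :
    (∀ t ∈ Set.Icc a b, ‖x t - x a‖ ≤ M * δ) ∧
    ‖y - x b‖ ^ 2 / (2 * α ^ 2) ≤ ‖y - x a‖ ^ 2 / (2 * α ^ 2) +
      δ * (⟪(α ^ 2)⁻¹ • (x a - y), g y⟫ + Z * (Lf * (Z * α ^ 2 + M * δ))) +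
      δ * (M ^ 2 * δ / (2 * α ^ 2)) := by
  have hab : a < b := by linarith
  have hba : b - a = δ := by linarith
  have hnear : ∀ z, ‖z - x a‖ ≤ 1 → ‖z‖ ≤ ρ := by
    intro z hz
    have := norm_sub_norm_le z (x a)
    linarith
  obtain ⟨hi, hd⟩ := traj_aux g hg x a b hab M hx (fun z hz => hM z (hnear z hz))
    (by rw [hba]; exact hMδ)
  rw [hba] at hd
  refine ⟨hd, ?_⟩
  have he := traj_aux2 g x a b hab (hx b ⟨hab.le, le_rfl⟩) hi (g y) (Lf * (Z * α ^ 2 + M * δ)) (by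
    intro t ht
    refine (hgL _ _ (hnear _ ((hd t ht).trans hMδ.le)) hy).trans ?_
    refine mul_le_mul_of_nonneg_left ?_ hLf
    have h1 : x t - y = (x t - x a) - (y - x a) := by abel
    rw [h1]
    have := norm_sub_le (x t - x a) (y - x a)
    linarith [hd t ht])
  rw [hba] at he
  have hζ : ‖(α ^ 2)⁻¹ • (x a - y)‖ ≤ Z := by
    rw [norm_smul, norm_inv, Real.norm_of_nonneg (by positivity), norm_sub_rev,
      inv_mul_le_iff₀ (by positivity)]
    linarith
  rw [prox_id α (x a) y (x b)]
  set ζ := (α ^ 2)⁻¹ • (x a - y)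
  have hin : ⟪ζ, x b - x a⟫ ≤ δ * (⟪ζ, g y⟫ + Z * (Lf * (Z * α ^ 2 + M * δ))) := by
    have h1 : x b - x a = δ • g y + (x b - x a - δ • g y) := by abel
    rw [h1, inner_add_right, real_inner_smul_right]
    have h2 := (real_inner_le_norm ζ (x b - x a - δ • g y)).trans
      (mul_le_mul hζ he (norm_nonneg _) hZ)
    linarith
  have hlast : ‖x b - x a‖ ^ 2 / (2 * α ^ 2) ≤ δ * (M ^ 2 * δ / (2 * α ^ 2)) := by
    have h3 : δ * (M ^ 2 * δ / (2 * α ^ 2)) = (M * δ) ^ 2 / (2 * α ^ 2) := by ring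
    rw [h3]
    have := hd b ⟨hab.le, le_rfl⟩
    gcongr
  linarith

set_option maxHeartbeats 4000000 in
/-- Theorem 1: practical sample-and-hold stabilization by the approximate
inf-convolution feedback under approximate optimizers.  The lower directional Dini derivative
is written as `liminf_{μ→0⁺} (V(x + μϑ) − V(x))/μ`. -/
theorem stmt_14 (n m : ℕ) (U : Set (EuclideanSpace ℝ (Fin m)))
    (f : EuclideanSpace ℝ (Fin n) → EuclideanSpace ℝ (Fin m) → EuclideanSpace ℝ (Fin n))
    -- local Lipschitz condition on `f`, uniformly over the admissible inputs
    (hfLip : ∀ (c : EuclideanSpace ℝ (Fin n)) (r : ℝ), 0 < r →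
      ∃ L : ℝ, 0 ≤ L ∧ ∀ a b : EuclideanSpace ℝ (Fin n), ‖a - c‖ ≤ r → ‖b - c‖ ≤ r →
        ∀ u ∈ U, ‖f a u - f b u‖ ≤ L * ‖a - b‖)
    (V : EuclideanSpace ℝ (Fin n) → ℝ)
    (hVLip : LocallyLipschitz V)
    (hV0 : V 0 = 0) (hVpos : ∀ x : EuclideanSpace ℝ (Fin n), x ≠ 0 → 0 < V x)
    (hVrad : Tendsto V (comap (fun x : EuclideanSpace ℝ (Fin n) => ‖x‖) atTop) atTop)
    (w : EuclideanSpace ℝ (Fin n) → ℝ) (hwcont : Continuous w)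
    (hwpos : ∀ x : EuclideanSpace ℝ (Fin n), x ≠ 0 → 0 < w x)
    -- decay condition of the CLF
    (hdecay : ∀ X : Set (EuclideanSpace ℝ (Fin n)), IsCompact X →
      ∃ UX : Set (EuclideanSpace ℝ (Fin m)), UX ⊆ U ∧ IsCompact UX ∧ UX.Nonempty ∧
        ∀ x ∈ X, sInf ((fun ϑ : EuclideanSpace ℝ (Fin n) =>
            liminf (fun μ : ℝ => (V (x + μ • ϑ) - V x) / μ) (nhdsWithin 0 (Set.Ioi 0))) ''
            (closure (convexHull ℝ ((fun u => f x u) '' UX)))) ≤ -w x)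
    -- Assumption 1: locally uniform lower Dini differentiability of `V`
    (hDini : ∀ Y F : Set (EuclideanSpace ℝ (Fin n)), IsCompact Y → IsCompact F →
      ∀ ν : ℝ, 0 < ν → ∃ μ : ℝ, 0 < μ ∧ ∀ y ∈ Y, ∀ ϑ ∈ F, ∀ μ' : ℝ, 0 < μ' → μ' ≤ μ →
        |(V (y + μ' • ϑ) - V y) / μ' -
            liminf (fun s : ℝ => (V (y + s • ϑ) - V y) / s) (nhdsWithin 0 (Set.Ioi 0))| ≤ ν) :
    ∀ R r : ℝ, 0 < r → r < R →
      ∃ δ : ℝ, 0 < δ ∧ ∃ α : ℝ, 0 < α ∧ α < 1 ∧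
        ∃ Ustar : Set (EuclideanSpace ℝ (Fin m)), Ustar ⊆ U ∧ IsCompact Ustar ∧
          Ustar.Nonempty ∧
        ∃ T : ℝ, 0 < T ∧ ∃ Θ : ℝ, 0 < Θ ∧
        ∃ εbar : EuclideanSpace ℝ (Fin n) → ℝ, (∀ z, 0 < εbar z) ∧
        ∃ ηbar : ℝ, 0 < ηbar ∧
        ∀ (x : ℝ → EuclideanSpace ℝ (Fin n)) (u : ℕ → EuclideanSpace ℝ (Fin m))
          (y : ℕ → EuclideanSpace ℝ (Fin n)),
          ‖x 0‖ ≤ R →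
          -- `y k` is an `εbar(x_k)²`-minimizer of the inf-convolution at the sample state
          (∀ k : ℕ, V (y k) + ‖y k - x (k * δ)‖ ^ 2 / (2 * α ^ 2) ≤
            (⨅ z : EuclideanSpace ℝ (Fin n), (V z + ‖z - x (k * δ)‖ ^ 2 / (2 * α ^ 2))) +
              (εbar (x (k * δ))) ^ 2) →
          -- `u k ∈ U*` is an `ηbar`-approximate optimizer for the subgradient decay problem
          (∀ k : ℕ, u k ∈ Ustar) →
          (∀ k : ℕ, ⟪(α ^ 2)⁻¹ • (x (k * δ) - y k), f (y k) (u k)⟫ ≤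
            sInf ((fun uu => ⟪(α ^ 2)⁻¹ • (x (k * δ) - y k), f (y k) uu⟫) '' Ustar) + ηbar) →
          -- sample-and-hold trajectory in integral form
          (∀ k : ℕ, ∀ t ∈ Set.Icc ((k : ℝ) * δ) (((k : ℝ) + 1) * δ),
            x t = x (k * δ) + ∫ τ in ((k : ℝ) * δ)..t, f (x τ) (u k)) →
          (∀ t : ℝ, 0 ≤ t → V (x t) ≤ Θ) ∧ (∀ t : ℝ, T ≤ t → ‖x t‖ ≤ r) := by
  intro R r hr hrR
  set D : EuclideanSpace ℝ (Fin n) → EuclideanSpace ℝ (Fin n) → ℝ := fun x ϑ =>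
    liminf (fun μ : ℝ => (V (x + μ • ϑ) - V x) / μ) (nhdsWithin 0 (Set.Ioi 0)) with hDdef
  have hVc : Continuous V := hVLip.continuous
  have hVnn : ∀ z, 0 ≤ V z := by
    intro z
    rcases eq_or_ne z 0 with h | h
    · rw [h, hV0]
    · exact (hVpos z h).le
  have hDc : Continuous (fun p : EuclideanSpace ℝ (Fin n) × EuclideanSpace ℝ (Fin n) =>
      D p.1 p.2) := dini_cont V hVc D hDini
  have hfc : ∀ u ∈ U, Continuous (fun z => f z u) := by
    intro u hu
    rw [continuous_iff_continuousAt]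
    intro c
    obtain ⟨L, hL0, hL⟩ := hfLip c 1 one_pos
    refine continuousAt_of_locally_lipschitz one_pos L ?_
    intro z hz
    rw [dist_eq_norm, dist_eq_norm]
    rw [dist_eq_norm] at hz
    exact hL z c hz.le (by simp) u hu
  -- sublevel sets are bounded
  have hsub : ∀ c : ℝ, ∃ ρ : ℝ, 0 ≤ ρ ∧ ∀ z, V z ≤ c → ‖z‖ ≤ ρ := by
    intro c
    have h1 := hVrad.eventually (eventually_gt_atTop c)
    rw [eventually_comap] at h1
    obtain ⟨N, hN⟩ := eventually_atTop.mp h1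
    refine ⟨max N 0, le_max_right _ _, fun z hz => ?_⟩
    by_contra hcon
    push Not at hcon
    exact absurd (hN ‖z‖ ((le_max_left _ _).trans hcon.le) z rfl) (not_lt.mpr hz)
  -- small sublevel set inside the ball of radius `r`
  obtain ⟨v, hv0, hv1, hvr⟩ : ∃ v : ℝ, 0 < v ∧ v ≤ 1 ∧ ∀ z, V z < v → ‖z‖ ≤ r := by
    obtain ⟨ρ, _, hρ⟩ := hsub 1
    have hcomp : IsCompact (Metric.closedBall (0 : EuclideanSpace ℝ (Fin n)) ρ \
        Metric.ball 0 r) := (isCompact_closedBall _ _).diff Metric.isOpen_ball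
    rcases (Metric.closedBall (0 : EuclideanSpace ℝ (Fin n)) ρ \
        Metric.ball 0 r).eq_empty_or_nonempty with he | hne
    · refine ⟨1, one_pos, le_rfl, fun z hz => ?_⟩
      by_contra hcon
      push Not at hcon
      have : z ∈ Metric.closedBall (0 : EuclideanSpace ℝ (Fin n)) ρ \ Metric.ball 0 r :=
        ⟨by simpa using hρ z hz.le, by simpa using hcon.le⟩
      rw [he] at this
      exact this
    · obtain ⟨p, hp, hpm⟩ := hcomp.exists_isMinOn hne hVc.continuousOn
      have hp0 : p ≠ 0 := by
        intro h
        apply hp.2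
        rw [h]; simpa using hr
      refine ⟨min 1 (V p), lt_min one_pos (hVpos p hp0), min_le_left _ _, fun z hz => ?_⟩
      by_contra hcon
      push Not at hcon
      have hz2 : z ∈ Metric.closedBall (0 : EuclideanSpace ℝ (Fin n)) ρ \ Metric.ball 0 r :=
        ⟨by simpa using hρ z (hz.le.trans (min_le_left _ _)), by simpa using hcon.le⟩
      have h3 : V p ≤ V z := hpm hz2
      exact absurd (hz.trans_le (min_le_right _ _)) (not_lt.mpr h3)
  obtain ⟨r0, hr0, hr0V⟩ : ∃ r0 : ℝ, 0 < r0 ∧ ∀ z, ‖z‖ < r0 → V z ≤ v / 4 := by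
    have h1 : ∀ᶠ z in nhds (0 : EuclideanSpace ℝ (Fin n)), V z < v / 4 :=
      hVc.continuousAt.eventually_lt continuousAt_const (by rw [hV0]; linarith)
    obtain ⟨e, he, h⟩ := Metric.eventually_nhds_iff.mp h1
    exact ⟨e, he, fun z hz => (h (by simpa using hz)).le⟩
  obtain ⟨c0, hc00, hc0⟩ : ∃ c0 : ℝ, 0 ≤ c0 ∧ ∀ z, ‖z‖ ≤ R → V z ≤ c0 := by
    obtain ⟨C, hC⟩ := (isCompact_closedBall (0 : EuclideanSpace ℝ (Fin n)) R).bddAbove_image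
      hVc.continuousOn
    refine ⟨max C 0, le_max_right _ _, fun z hz => ?_⟩
    exact (hC ⟨z, by simpa using hz, rfl⟩).trans (le_max_left _ _)
  obtain ⟨ρ₀, hρ₀0, hρ₀⟩ := hsub (c0 + 2)
  obtain ⟨ρ, hρ⟩ : ∃ ρ, ρ = ρ₀ + 2 * (c0 + 2) + 1 := ⟨_, rfl⟩
  have hρpos : 0 < ρ := by linarith
  obtain ⟨LV, hLV0, hLV⟩ : ∃ LV : ℝ, 0 ≤ LV ∧ ∀ a b, ‖a‖ ≤ ρ → ‖b‖ ≤ ρ →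
      |V a - V b| ≤ LV * ‖a - b‖ := by
    obtain ⟨K, hK⟩ := (hVLip.locallyLipschitzOn (s := Metric.closedBall 0 ρ)
      ).exists_lipschitzOnWith_of_compact (isCompact_closedBall _ _)
    refine ⟨K, K.2, fun a b ha hb => ?_⟩
    have := hK.dist_le_mul a (by simpa using ha) b (by simpa using hb)
    rwa [Real.dist_eq, dist_eq_norm] at this
  obtain ⟨Lf, hLf0, hLf'⟩ := hfLip 0 ρ hρpos
  have hLf : ∀ u ∈ U, ∀ a b, ‖a‖ ≤ ρ → ‖b‖ ≤ ρ → ‖f a u - f b u‖ ≤ Lf * ‖a - b‖ := by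
    intro u hu a b ha hb
    exact hLf' a b (by simpa using ha) (by simpa using hb) u hu
  -- the compact annulus
  obtain ⟨K, hKdef⟩ : ∃ K, K = Metric.closedBall (0 : EuclideanSpace ℝ (Fin n)) ρ \
    Metric.ball 0 r0 := ⟨_, rfl⟩
  have hK : IsCompact K := by
    rw [hKdef]; exact (isCompact_closedBall _ _).diff Metric.isOpen_ball
  have hKmem : ∀ z, ‖z‖ ≤ ρ → r0 ≤ ‖z‖ → z ∈ K := by
    intro z h1 h2
    rw [hKdef]
    exact ⟨by simpa using h1, by simpa using h2⟩
  have hK0 : ∀ z ∈ K, z ≠ 0 := by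
    intro z hz h
    rw [hKdef] at hz
    apply hz.2
    rw [h]; simpa using hr0
  obtain ⟨ω, hω, hωK⟩ : ∃ ω : ℝ, 0 < ω ∧ ∀ z ∈ K, ω < w z := by
    rcases K.eq_empty_or_nonempty with he | hne
    · exact ⟨1, one_pos, by simp [he]⟩
    · obtain ⟨p, hp, hpm⟩ := hK.exists_isMinOn hne hwcont.continuousOn
      have hwp := hwpos p (hK0 p hp)
      refine ⟨w p / 2, by linarith, fun z hz => ?_⟩
      have h3 : w p ≤ w z := hpm hz
      linarith
  obtain ⟨UX, hUX, -, hUXne, hUXd⟩ := hdecay K hK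
  obtain ⟨S, hSU, hSfin, hSne, hS⟩ := finite_controls f D U UX hUX hUXne hfc hDc K hK ω (by
    intro z hz
    have h1 := hUXd z hz
    have h2 := hωK z hz
    by_contra hcon
    push Not at hcon
    rcases (closure (convexHull ℝ ((fun u => f z u) '' UX))).eq_empty_or_nonempty with he | hne
    · rw [he] at h1
      simp only [Set.image_empty, Real.sInf_empty] at h1
      linarith
    · have h3 := le_csInf (hne.image (fun ϑ => D z ϑ)) (a := -ω) (by
        rintro _ ⟨ϑ, hϑ, rfl⟩
        exact hcon ϑ hϑ)
      have h4 : sInf ((fun ϑ => D z ϑ) '' closure (convexHull ℝ ((fun u => f z u) '' UX)))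
        ≤ -w z := h1
      linarith)
  obtain ⟨M, hM1, hM⟩ : ∃ M : ℝ, 1 ≤ M ∧ ∀ u ∈ S, ∀ z, ‖z‖ ≤ ρ → ‖f z u‖ ≤ M := by
    obtain ⟨C, hC⟩ := (hSfin.image (fun u => ‖f 0 u‖)).bddAbove
    refine ⟨max 1 (C + Lf * ρ), le_max_left _ _, fun u hu z hz => ?_⟩
    have h1 : ‖f 0 u‖ ≤ C := hC ⟨u, hu, rfl⟩
    have h2 := hLf u (hSU hu) z 0 hz (by simpa using hρpos.le)
    rw [sub_zero] at h2
    have h3 := norm_sub_norm_le (f z u) (f 0 u)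
    have h4 : Lf * ‖z‖ ≤ Lf * ρ := mul_le_mul_of_nonneg_left hz hLf0
    exact le_trans (by linarith) (le_max_right _ _)
  obtain ⟨Z, hZ⟩ : ∃ Z, Z = 2 * LV + 2 := ⟨_, rfl⟩
  have hZ0 : 0 ≤ Z := by linarith
  obtain ⟨μ₀, hμ₀, hμ₀D⟩ := hDini (Metric.closedBall 0 ρ) (Metric.closedBall 0 M)
    (isCompact_closedBall _ _) (isCompact_closedBall _ _) (ω / 16) (by linarith)
  -- choice of α
  obtain ⟨α, hα0, hα1, hαa, hαb, hαc⟩ : ∃ α : ℝ, 0 < α ∧ α < 1 ∧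
      (Z * Lf * Z) * α ^ 2 ≤ ω / 16 ∧ (LV * Z) * α ^ 2 ≤ v / 8 ∧
      ((Z + M) ^ 2 / 2) * α ^ 2 ≤ v / 8 := by
    obtain ⟨a1, h1, h1'⟩ := small_aux (Z * Lf * Z) (ω / 16) (by positivity) (by linarith)
    obtain ⟨a2, h2, h2'⟩ := small_aux (LV * Z) (v / 8) (by positivity) (by linarith)
    obtain ⟨a3, h3, h3'⟩ := small_aux ((Z + M) ^ 2 / 2) (v / 8) (by positivity) (by linarith)
    obtain ⟨α, hα⟩ : ∃ α, α = min (1 / 2) (min a1 (min a2 a3)) := ⟨_, rfl⟩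
    have p0 : 0 < α := by rw [hα]; positivity
    have q0 : α ≤ 1 / 2 := by rw [hα]; exact min_le_left _ _
    have q1 : α ≤ a1 := by rw [hα]; exact (min_le_right _ _).trans (min_le_left _ _)
    have q2 : α ≤ a2 := by
      rw [hα]; exact (min_le_right _ _).trans ((min_le_right _ _).trans (min_le_left _ _))
    have q3 : α ≤ a3 := by
      rw [hα]; exact (min_le_right _ _).trans ((min_le_right _ _).trans (min_le_right _ _))
    have hsq : α ^ 2 ≤ α := by nlinarith
    have hsp : 0 < α ^ 2 := by positivity
    exact ⟨α, p0, by linarith, h1' _ hsp (by linarith), h2' _ hsp (by linarith),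
      h3' _ hsp (by linarith)⟩
  have hα2 : 0 < α ^ 2 := by positivity
  -- choice of δ
  obtain ⟨δ, hδ0, hδα, hδa, hδb, hδc, hδd⟩ : ∃ δ : ℝ, 0 < δ ∧ δ ≤ α ^ 2 ∧ M * δ ≤ 1 / 2 ∧
      (Z * Lf * M) * δ ≤ ω / 16 ∧ (M ^ 2 / (2 * α ^ 2)) * δ ≤ ω / 16 ∧
      (LV * M) * δ ≤ v / 8 := by
    obtain ⟨a1, h1, h1'⟩ := small_aux M (1 / 2) (by positivity) (by norm_num)
    obtain ⟨a2, h2, h2'⟩ := small_aux (Z * Lf * M) (ω / 16) (by positivity) (by linarith)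
    obtain ⟨a3, h3, h3'⟩ := small_aux (M ^ 2 / (2 * α ^ 2)) (ω / 16) (by positivity) (by linarith)
    obtain ⟨a4, h4, h4'⟩ := small_aux (LV * M) (v / 8) (by positivity) (by linarith)
    obtain ⟨δ, hδ⟩ : ∃ δ, δ = min (α ^ 2) (min (min a1 a2) (min a3 a4)) := ⟨_, rfl⟩
    have p0 : 0 < δ := by rw [hδ]; positivity
    have q : δ ≤ α ^ 2 ∧ (δ ≤ a1 ∧ δ ≤ a2) ∧ (δ ≤ a3 ∧ δ ≤ a4) := by
      rw [← le_min_iff, ← le_min_iff, ← le_min_iff, ← le_min_iff, hδ]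
    exact ⟨δ, p0, q.1, h1' _ p0 q.2.1.1, h2' _ p0 q.2.1.2, h3' _ p0 q.2.2.1, h4' _ p0 q.2.2.2⟩
  -- choice of the difference step
  obtain ⟨μ, hμ0, hμμ, hμa⟩ : ∃ μ : ℝ, 0 < μ ∧ μ ≤ μ₀ ∧ (M ^ 2 / (2 * α ^ 2)) * μ ≤ ω / 16 := by
    obtain ⟨a1, h1, h1'⟩ := small_aux (M ^ 2 / (2 * α ^ 2)) (ω / 16) (by positivity) (by linarith)
    exact ⟨min μ₀ a1, lt_min hμ₀ h1, min_le_left _ _,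
      h1' _ (lt_min hμ₀ h1) (min_le_right _ _)⟩
  -- choice of ε
  obtain ⟨ε, hε0, hεα, hεa, hεb, hεc⟩ : ∃ ε : ℝ, 0 < ε ∧ ε ≤ α ∧ ε ^ 2 ≤ μ * (ω / 16) ∧
      ε ^ 2 ≤ δ * (ω / 16) ∧ ε ^ 2 ≤ v / 8 := by
    obtain ⟨ε, hε⟩ : ∃ ε, ε = min α (min (μ * (ω / 16)) (min (δ * (ω / 16)) (v / 8))) := ⟨_, rfl⟩
    have p0 : 0 < ε := by rw [hε]; positivity
    have q : ε ≤ α ∧ ε ≤ μ * (ω / 16) ∧ ε ≤ δ * (ω / 16) ∧ ε ≤ v / 8 := by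
      rw [← le_min_iff, ← le_min_iff, ← le_min_iff, hε]
    have hsq : ε ^ 2 ≤ ε := by nlinarith [q.1]
    exact ⟨ε, p0, q.1, by linarith [q.2.1], by linarith [q.2.2.1], by linarith [q.2.2.2]⟩
  have hε1 : ε ^ 2 ≤ 1 := by linarith
  -- number of steps
  obtain ⟨N, hN⟩ := exists_nat_ge (c0 / (δ * (ω / 2)))
  have hN' : c0 - N * (δ * (ω / 2)) ≤ 0 := by
    rw [div_le_iff₀ (by positivity)] at hN
    linarith
  refine ⟨δ, hδ0, α, hα0, hα1, S, hSU, hSfin.isCompact, hSne, (N + 1) * δ, by positivity,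
    c0 + 2, by linarith, fun _ => ε, fun _ => hε0, ω / 16, by linarith, ?_⟩
  intro x u y hx0 hy huS hu hx
  obtain ⟨W, hW⟩ : ∃ W : EuclideanSpace ℝ (Fin n) → ℝ, W = fun p => 
    ⨅ z : EuclideanSpace ℝ (Fin n), (V z + ‖z - p‖ ^ 2 / (2 * α ^ 2)) := ⟨_, rfl⟩
  have hWle : ∀ p z, W p ≤ V z + ‖z - p‖ ^ 2 / (2 * α ^ 2) := by
    intro p z
    rw [hW]
    refine ciInf_le ⟨0, ?_⟩ z
    rintro _ ⟨z, rfl⟩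
    have := hVnn z
    positivity
  have hWV : ∀ p, W p ≤ V p := by
    intro p
    have := hWle p p
    simpa using this
  have hyW : ∀ k : ℕ, V (y k) + ‖y k - x (k * δ)‖ ^ 2 / (2 * α ^ 2) ≤ W (x (k * δ)) + ε ^ 2 := by
    intro k
    rw [hW]
    exact hy k
  clear hy
  -- the one-step estimate
  have step : ∀ k : ℕ, W (x (k * δ)) ≤ c0 + 1 →
      (W (x ((k + 1 : ℕ) * δ)) ≤ max (W (x (k * δ)) - δ * (ω / 2)) (3 * v / 8)) ∧
      ∀ t ∈ Set.Icc ((k : ℝ) * δ) (((k : ℝ) + 1) * δ),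
        V (x t) ≤ W (x (k * δ)) + 3 * v / 8 := by
    intro k hk
    have hyk := hyW k
    have huk := hu k
    have hxk := hx k
    obtain ⟨a, ha⟩ : ∃ a : ℝ, a = k * δ := ⟨_, rfl⟩
    have hb : ((k : ℝ) + 1) * δ = a + δ := by rw [ha]; ring
    have hb' : ((k + 1 : ℕ) : ℝ) * δ = a + δ := by rw [ha]; push_cast; ring
    rw [hb']
    rw [hb] at hxk ⊢
    rw [← ha] at hk hyk huk hxk ⊢
    obtain ⟨hy1, hxa, hyx⟩ := prox_bounds V hVnn (c0 + 2) ρ₀ ρ LV α ε (by linarith) hρ₀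
      (by linarith) hLV0 hLV hα0 hα1 hε0 hεα (x a) (y k) (by linarith)
      (by linarith [hWV (x a)])
    rw [← hZ] at hyx
    have hyρ : ‖y k‖ ≤ ρ := by linarith
    obtain ⟨hd, hone⟩ := one_step (fun z => f z (u k)) (hfc _ (hSU (huS k))) x (y k) a (a + δ) δ M ρ
      Lf Z α hδ0 rfl hZ0 hLf0 hα0 hxk (hM _ (huS k)) (hLf _ (hSU (huS k))) (by linarith) hyρ
      (by linarith) hyx
    have hWb := hWle (x (a + δ)) (y k)
    have hVyx := (abs_le.mp (hLV (y k) (x a) hyρ (by linarith))).1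
    have hLVyx : LV * ‖y k - x a‖ ≤ v / 8 := by
      calc LV * ‖y k - x a‖ ≤ LV * (Z * α ^ 2) := mul_le_mul_of_nonneg_left hyx hLV0
        _ = (LV * Z) * α ^ 2 := by ring
        _ ≤ _ := hαb
    have hqa : 0 ≤ ‖y k - x a‖ ^ 2 / (2 * α ^ 2) := by positivity
    refine ⟨?_, ?_⟩
    · rcases lt_or_ge ‖y k‖ r0 with hlt | hge
      · apply le_max_of_le_right
        have h1 := hr0V _ hlt
        have h2 : ‖y k - x (a + δ)‖ ≤ (Z + M) * α ^ 2 := by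
          have e1 : y k - x (a + δ) = (y k - x a) - (x (a + δ) - x a) := by abel
          rw [e1]
          have e2 := norm_sub_le (y k - x a) (x (a + δ) - x a)
          have e3 := hd (a + δ) ⟨by linarith, le_rfl⟩
          have e4 : M * δ ≤ M * α ^ 2 := mul_le_mul_of_nonneg_left hδα (by linarith)
          linarith
        have h3 : ‖y k - x (a + δ)‖ ^ 2 / (2 * α ^ 2) ≤ v / 8 := by
          refine le_trans ?_ hαc
          rw [div_le_iff₀ (by positivity)]
          have : ‖y k - x (a + δ)‖ ^ 2 ≤ ((Z + M) * α ^ 2) ^ 2 := by gcongr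
          linarith
        linarith
      · apply le_max_of_le_left
        obtain ⟨ϑ, hϑ, hDϑ⟩ := hS (y k) (hKmem _ hyρ hge)
        have hϑM : ‖ϑ‖ ≤ M := by
          have : convexHull ℝ ((fun u => f (y k) u) '' S) ⊆ Metric.closedBall 0 M := by
            refine convexHull_min ?_ (convex_closedBall _ _)
            rintro _ ⟨uu, huu, rfl⟩
            simpa using hM uu huu _ hyρ
          simpa using this hϑ
        have hq := hμ₀D (y k) (by simpa using hyρ) ϑ (by simpa using hϑM) μ hμ0 hμμ
        have hq2 : (V (y k + μ • ϑ) - V (y k)) / μ - D (y k) ϑ ≤ ω / 16 := (abs_le.mp hq).2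
        have hg := prox_grad V α ε μ hμ0 (x a) (y k) ϑ (by
          have := hWle (x a) (y k + μ • ϑ)
          linarith)
        have hg2 : μ * (‖ϑ‖ ^ 2 / (2 * α ^ 2)) ≤ ω / 16 := by
          refine le_trans ?_ hμa
          rw [mul_comm]
          gcongr
        have hg3 : ε ^ 2 / μ ≤ ω / 16 := by
          rw [div_le_iff₀ hμ0]; linarith
        have hinf : sInf ((fun uu => ⟪(α ^ 2)⁻¹ • (x a - y k), f (y k) uu⟫) '' S) ≤
            ⟪(α ^ 2)⁻¹ • (x a - y k), ϑ⟫ := by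
          obtain ⟨ζ, hζ⟩ : ∃ ζ, ζ = (α ^ 2)⁻¹ • (x a - y k) := ⟨_, rfl⟩
          rw [← hζ]
          have hbdd := (hSfin.image (fun uu => ⟪ζ, f (y k) uu⟫)).bddBelow
          have hsub : convexHull ℝ ((fun u => f (y k) u) '' S) ⊆
              {p | sInf ((fun uu => ⟪ζ, f (y k) uu⟫) '' S) ≤ (innerSL ℝ ζ) p} := by
            refine convexHull_min ?_ (convex_halfSpace_ge (innerSL ℝ ζ).toLinearMap.isLinear _)
            rintro _ ⟨uu, huu, rfl⟩
            exact csInf_le hbdd ⟨uu, huu, rfl⟩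
          exact hsub hϑ
        have hI : ⟪(α ^ 2)⁻¹ • (x a - y k), f (y k) (u k)⟫ +
            Z * (Lf * (Z * α ^ 2 + M * δ)) ≤ -ω + 6 * (ω / 16) := by
          have : Z * (Lf * (Z * α ^ 2 + M * δ)) = (Z * Lf * Z) * α ^ 2 + (Z * Lf * M) * δ := by
            ring
          linarith
        have hI2 := mul_le_mul_of_nonneg_left hI hδ0.le
        have hJ : M ^ 2 * δ / (2 * α ^ 2) ≤ ω / 16 := by
          have : M ^ 2 * δ / (2 * α ^ 2) = (M ^ 2 / (2 * α ^ 2)) * δ := by ring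
          linarith
        have hJ2 := mul_le_mul_of_nonneg_left hJ hδ0.le
        linarith
    · intro t ht
      have h1 := hd t ht
      have hxt : ‖x t‖ ≤ ρ := by
        have := norm_sub_norm_le (x t) (x a)
        linarith
      have h2 := (abs_le.mp (hLV (x t) (x a) hxt (by linarith))).2
      have h3 : LV * ‖x t - x a‖ ≤ v / 8 := by
        calc LV * ‖x t - x a‖ ≤ LV * (M * δ) := mul_le_mul_of_nonneg_left h1 hLV0
          _ = (LV * M) * δ := by ring
          _ ≤ _ := hδd
      linarith
  have hind : ∀ k : ℕ, W (x (k * δ)) ≤ max (c0 - k * (δ * (ω / 2))) (3 * v / 8) := by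
    intro k
    induction k with
    | zero =>
      apply le_max_of_le_left
      simp only [Nat.cast_zero, zero_mul, sub_zero]
      exact (hWV _).trans (hc0 _ hx0)
    | succ k ih =>
      have hpos : 0 ≤ (k : ℝ) * (δ * (ω / 2)) := by positivity
      have h1 := (step k (ih.trans (max_le (by linarith) (by linarith)))).1
      have hp : 0 < δ * (ω / 2) := by positivity
      refine h1.trans (max_le ?_ (le_max_right _ _))
      rcases le_max_iff.mp ih with h | h
      · apply le_max_of_le_left
        push_cast
        linarith
      · apply le_max_of_le_right
        linarith
  have hbd : ∀ k : ℕ, W (x (k * δ)) ≤ c0 + 1 := by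
    intro k
    have hpos : 0 ≤ (k : ℝ) * (δ * (ω / 2)) := by positivity
    exact (hind k).trans (max_le (by linarith) (by linarith))
  have hloc : ∀ t : ℝ, 0 ≤ t → ∃ k : ℕ, t ∈ Set.Icc ((k : ℝ) * δ) (((k : ℝ) + 1) * δ) := by
    intro t ht
    refine ⟨⌊t / δ⌋₊, ?_, ?_⟩
    · rw [← le_div_iff₀ hδ0]
      exact Nat.floor_le (by positivity)
    · rw [← div_le_iff₀ hδ0]
      exact (Nat.lt_floor_add_one _).le
  refine ⟨?_, ?_⟩
  · intro t ht
    obtain ⟨k, hk⟩ := hloc t ht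
    have := (step k (hbd k)).2 t hk
    linarith [hbd k]
  · intro t ht
    obtain ⟨k, hk⟩ := hloc t (le_trans (by positivity) ht)
    have hkN : (N : ℝ) ≤ k := by
      have h1 := ht.trans hk.2
      have h2 := le_of_mul_le_mul_right h1 hδ0
      linarith
    have h3 : (N : ℝ) * (δ * (ω / 2)) ≤ k * (δ * (ω / 2)) :=
      mul_le_mul_of_nonneg_right hkN (by positivity)
    have h4 : W (x (k * δ)) ≤ 3 * v / 8 :=
      (hind k).trans (max_le (by linarith) le_rfl)
    have := (step k (hbd k)).2 t hk
    exact hvr _ (by linarith)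
end
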